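/- arXiv:1706.02731 — 11 statements merged into one kernel-verified Lean document; each statement's English description precedes it below -/
import Mathlib

section
/- For all real numbers a ≥ 0, b ≥ 0 and λ with 0 < λ < 1, the inequality λ·log₂(1 + a/λ) + (1−λ)·log₂(1 + b/(1−λ)) ≤ log₂(1 + a + b) holds. -/
/-- Two-user OMA sum-rate upper bound: for a, b ≥ 0 and 0 < λ < 1,
λ·log₂(1 + a/λ) + (1−λ)·log₂(1 + b/(1−λ)) ≤ log₂(1 + a + b). -/
theorem two_user_oma_upper_bound (a b lam : ℝ) (ha : 0 ≤ a) (hb : 0 ≤ b)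
    (hlam0 : 0 < lam) (hlam1 : lam < 1) :
    lam * Real.logb 2 (1 + a / lam) + (1 - lam) * Real.logb 2 (1 + b / (1 - lam)) ≤
      Real.logb 2 (1 + a + b) := by
  have h1 : 0 < 1 - lam := by linarith
  have hx : (0 : ℝ) < 1 + a / lam := by positivity
  have hy : (0 : ℝ) < 1 + b / (1 - lam) := by
    have := div_nonneg hb h1.le
    linarith
  have key := strictConcaveOn_log_Ioi.concaveOn.2 (Set.mem_Ioi.2 hx) (Set.mem_Ioi.2 hy)
    hlam0.le h1.le (by ring)
  simp only [smul_eq_mul] at key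
  have e : lam * (1 + a / lam) + (1 - lam) * (1 + b / (1 - lam)) = 1 + a + b := by
    rw [mul_add, mul_add, mul_div_cancel₀ _ hlam0.ne', mul_div_cancel₀ _ h1.ne']
    ring
  rw [e] at key
  have h2 : 0 < Real.log 2 := Real.log_pos (by norm_num)
  simp only [Real.logb]
  rw [← mul_div_assoc, ← mul_div_assoc, ← add_div]
  exact div_le_div_of_nonneg_right key h2.le
end

section
/- Let L ≥ 1, let a₁,…,a_L ≥ 0 be real numbers, and let λ₁,…,λ_L > 0 satisfy ∑_{l=1}^L λ_l = 1. Then ∑_{l=1}^L λ_l·log₂(1 + a_l/λ_l) ≤ log₂(1 + ∑_{l=1}^L a_l). -/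
open Finset

/-- L-user OMA sum-rate upper bound: if λ_l > 0 sum to 1 and a_l ≥ 0, then
∑ λ_l·log₂(1 + a_l/λ_l) ≤ log₂(1 + ∑ a_l). -/
theorem oma_sum_rate_upper_bound (L : ℕ) (hL : 1 ≤ L) (a lam : ℕ → ℝ)
    (ha : ∀ l ∈ Finset.Icc 1 L, 0 ≤ a l)
    (hlam : ∀ l ∈ Finset.Icc 1 L, 0 < lam l)
    (hlam_sum : ∑ l ∈ Finset.Icc 1 L, lam l = 1) :
    ∑ l ∈ Finset.Icc 1 L, lam l * Real.logb 2 (1 + a l / lam l) ≤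
      Real.logb 2 (1 + ∑ l ∈ Finset.Icc 1 L, a l) := by
  have key := strictConcaveOn_log_Ioi.concaveOn.le_map_sum (t := Finset.Icc 1 L) (w := lam)
    (p := fun l => 1 + a l / lam l) (fun i hi => (hlam i hi).le) hlam_sum
    (fun i hi => by
      have h := div_nonneg (ha i hi) (hlam i hi).le
      simp only [Set.mem_Ioi]
      linarith)
  have hs : ∑ l ∈ Finset.Icc 1 L, lam l • (1 + a l / lam l)
      = 1 + ∑ l ∈ Finset.Icc 1 L, a l := by
    rw [← hlam_sum, ← Finset.sum_add_distrib]
    refine Finset.sum_congr rfl fun i hi => ?_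
    have h := (hlam i hi).ne'
    rw [hlam_sum, smul_eq_mul]
    field_simp
  rw [hs] at key
  simp only [smul_eq_mul] at key
  simp only [Real.logb, ← mul_div_assoc]
  rw [← Finset.sum_div]
  exact div_le_div_of_nonneg_right key (Real.log_nonneg (by norm_num))
end

section
/- Let L ≥ 1, let ρ > 0, let g₁ ≥ g₂ ≥ … ≥ g_L > 0 be real numbers, and let Ω₁,…,Ω_L ≥ 0. Then the MIMO-NOMA sum rate satisfies ∑_{l=1}^L log₂(1 + ρ·Ω_l·g_l / (1 + ρ·g_l·∑_{k=1}^{l−1} Ω_k)) ≥ log₂(1 + ρ·∑_{l=1}^L Ω_l·g_l). -/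
open Finset

/-- Lower bound on the MIMO-NOMA sum rate: with ordered gains g₁ ≥ … ≥ g_L > 0 and
nonnegative power coefficients, the NOMA sum rate is at least log₂(1 + ρ·∑ Ω_l g_l). -/
theorem noma_sum_rate_lower_bound (L : ℕ) (hL : 1 ≤ L) (ρ : ℝ) (hρ : 0 < ρ) (g Ω : ℕ → ℝ)
    (hg_pos : ∀ i ∈ Finset.Icc 1 L, 0 < g i)
    (hg_mono : ∀ i j, 1 ≤ i → i ≤ j → j ≤ L → g j ≤ g i)
    (hΩ : ∀ i ∈ Finset.Icc 1 L, 0 ≤ Ω i) :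
    ∑ l ∈ Finset.Icc 1 L,
        Real.logb 2 (1 + ρ * Ω l * g l / (1 + ρ * g l * ∑ k ∈ Finset.Ico 1 l, Ω k)) ≥
      Real.logb 2 (1 + ρ * ∑ l ∈ Finset.Icc 1 L, Ω l * g l) := by
  have key : ∀ n, n ≤ L → Real.logb 2 (1 + ρ * ∑ l ∈ Finset.Icc 1 n, Ω l * g l) ≤
      ∑ l ∈ Finset.Icc 1 n,
        Real.logb 2 (1 + ρ * Ω l * g l / (1 + ρ * g l * ∑ k ∈ Finset.Ico 1 l, Ω k)) := by
    intro n
    induction n with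
    | zero => intro _; simp
    | succ n ih =>
      intro hn
      have ih' := ih (by omega)
      rw [Finset.sum_Icc_succ_top (by omega), Finset.sum_Icc_succ_top (by omega)]
      have hI : Finset.Ico 1 (n + 1) = Finset.Icc 1 n := by
        ext x; simp only [Finset.mem_Ico, Finset.mem_Icc]; omega
      rw [hI]
      have hgn : 0 < g (n + 1) := hg_pos _ (Finset.mem_Icc.2 ⟨by omega, hn⟩)
      have hΩn : 0 ≤ Ω (n + 1) := hΩ _ (Finset.mem_Icc.2 ⟨by omega, hn⟩)
      have hS : 0 ≤ ∑ k ∈ Finset.Icc 1 n, Ω k := by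
        refine Finset.sum_nonneg fun k hk => hΩ k ?_
        rw [Finset.mem_Icc] at hk ⊢; omega
      have hA : g (n + 1) * ∑ k ∈ Finset.Icc 1 n, Ω k ≤ ∑ l ∈ Finset.Icc 1 n, Ω l * g l := by
        rw [Finset.mul_sum]
        refine Finset.sum_le_sum fun k hk => ?_
        rw [Finset.mem_Icc] at hk
        rw [mul_comm]
        exact mul_le_mul_of_nonneg_left (hg_mono k (n + 1) hk.1 (by omega) hn)
          (hΩ k (Finset.mem_Icc.2 ⟨hk.1, by omega⟩))
      generalize (∑ k ∈ Finset.Icc 1 n, Ω k) = S at *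
      generalize (∑ l ∈ Finset.Icc 1 n, Ω l * g l) = A at *
      have hgS : 0 ≤ g (n + 1) * S := by positivity
      have hD : 0 < 1 + ρ * g (n + 1) * S := by positivity
      have hA0 : 0 ≤ A := hgS.trans hA
      have hB : 0 < 1 + ρ * A := by positivity
      have hq : 0 ≤ ρ * Ω (n + 1) * g (n + 1) / (1 + ρ * g (n + 1) * S) := by positivity
      have hx : 0 ≤ ρ * Ω (n + 1) * g (n + 1) := by positivity
      refine le_trans ?_ (add_le_add_left ih' _)
      rw [← Real.logb_mul hB.ne' (by positivity)]
      apply Real.logb_le_logb_of_le (by norm_num) (by positivity)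
      have hle : 1 + ρ * g (n + 1) * S ≤ 1 + ρ * A := by
        have := mul_le_mul_of_nonneg_left hA hρ.le
        linarith
      have h1 := mul_le_mul_of_nonneg_right hle hq
      rw [mul_div_cancel₀ _ hD.ne'] at h1
      linarith
  exact key L le_rfl
end

section
/- Let L ≥ 1, let ρ > 0, let g₁ ≥ g₂ ≥ … ≥ g_L > 0, let Ω₁,…,Ω_L ≥ 0, and let λ₁,…,λ_L > 0 with ∑_{l=1}^L λ_l = 1. Then ∑_{l=1}^L log₂(1 + ρ·Ω_l·g_l / (1 + ρ·g_l·∑_{k=1}^{l−1} Ω_k)) ≥ ∑_{l=1}^L λ_l·log₂(1 + ρ·Ω_l·g_l/λ_l). That is, for any power split used by MIMO-OMA, MIMO-NOMA with the same power split achieves a sum rate at least as large. -/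
open Finset

lemma aux_conc {a b x y : ℝ} (ha : 0 ≤ a) (hb : 0 ≤ b) (hab : a + b = 1) (hx : 0 < x)
    (hy : 0 < y) : a * Real.log x + b * Real.log y ≤ Real.log (a * x + b * y) := by
  have := strictConcaveOn_log_Ioi.concaveOn.2 (Set.mem_Ioi.2 hx) (Set.mem_Ioi.2 hy) ha hb hab
  simpa using this

lemma aux_two {p q a b : ℝ} (hp : 0 < p) (hq : 0 < q) (ha : 0 ≤ a) (hb : 0 ≤ b) :
    p * Real.log (1 + a / p) + q * Real.log (1 + b / q) ≤
      (p + q) * Real.log (1 + (a + b) / (p + q)) := by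
  have hs : 0 < p + q := by positivity
  have h := aux_conc (a := p / (p + q)) (b := q / (p + q)) (x := 1 + a / p) (y := 1 + b / q)
    (by positivity) (by positivity) (by field_simp) (by positivity) (by positivity)
  have e : p / (p + q) * (1 + a / p) + q / (p + q) * (1 + b / q) = 1 + (a + b) / (p + q) := by
    field_simp
    ring
  rw [e] at h
  have h2 := mul_le_mul_of_nonneg_left h hs.le
  refine le_trans (le_of_eq ?_) h2
  field_simp

lemma aux_mono {p x y : ℝ} (hp : 0 < p) (hp1 : p ≤ 1) (hx : 0 ≤ x) (hxy : x ≤ y) :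
    Real.log (1 + x) - p * Real.log (1 + x / p) ≤ Real.log (1 + y) - p * Real.log (1 + y / p) := by
  have hy : 0 ≤ y := hx.trans hxy
  have h := aux_conc (a := p) (b := 1 - p) (x := (1 + y / p) / (1 + x / p)) (y := 1)
    hp.le (by linarith) (by ring) (by positivity) one_pos
  have h3 : p * ((1 + y / p) / (1 + x / p)) + (1 - p) * 1 ≤ (1 + y) / (1 + x) := by
    have e : (1 + y) / (1 + x) - (p * ((1 + y / p) / (1 + x / p)) + (1 - p) * 1)
        = (y - x) * (x * (1 - p)) / ((1 + x) * (p + x)) := by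
      field_simp
      ring
    have : 0 ≤ (y - x) * (x * (1 - p)) / ((1 + x) * (p + x)) :=
      div_nonneg (mul_nonneg (by linarith) (mul_nonneg hx (by linarith))) (by positivity)
    linarith
  have h0 : 0 < p * ((1 + y / p) / (1 + x / p)) + (1 - p) * 1 := by
    have : 0 < p * ((1 + y / p) / (1 + x / p)) := by positivity
    linarith
  have h4 := Real.log_le_log h0 h3
  rw [Real.log_div (by positivity) (by positivity)] at h h4
  simp only [Real.log_one] at h
  linarith

/-- For any power split used by MIMO-OMA, MIMO-NOMA with the same power split achieves a
sum rate at least as large. -/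
theorem noma_ge_oma_sum_rate (L : ℕ) (hL : 1 ≤ L) (ρ : ℝ) (hρ : 0 < ρ) (g Ω lam : ℕ → ℝ)
    (hg_pos : ∀ i ∈ Finset.Icc 1 L, 0 < g i)
    (hg_mono : ∀ i j, 1 ≤ i → i ≤ j → j ≤ L → g j ≤ g i)
    (hΩ : ∀ i ∈ Finset.Icc 1 L, 0 ≤ Ω i)
    (hlam : ∀ i ∈ Finset.Icc 1 L, 0 < lam i)
    (hlam_sum : ∑ l ∈ Finset.Icc 1 L, lam l = 1) :
    ∑ l ∈ Finset.Icc 1 L,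
        Real.logb 2 (1 + ρ * Ω l * g l / (1 + ρ * g l * ∑ k ∈ Finset.Ico 1 l, Ω k)) ≥
      ∑ l ∈ Finset.Icc 1 L, lam l * Real.logb 2 (1 + ρ * Ω l * g l / lam l) := by
  have key : ∀ m, 1 ≤ m → m ≤ L →
      Real.log (1 + ρ * g m * ∑ k ∈ Finset.Icc 1 m, Ω k) -
        (∑ k ∈ Finset.Icc 1 m, lam k) * Real.log (1 + (ρ * g m * ∑ k ∈ Finset.Icc 1 m, Ω k) /
          (∑ k ∈ Finset.Icc 1 m, lam k)) ≤
      ∑ l ∈ Finset.Icc 1 m,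
        Real.log (1 + ρ * Ω l * g l / (1 + ρ * g l * ∑ k ∈ Finset.Ico 1 l, Ω k)) -
      ∑ l ∈ Finset.Icc 1 m, lam l * Real.log (1 + ρ * Ω l * g l / lam l) := by
    intro m hm
    induction m, hm using Nat.le_induction with
    | base =>
      intro _
      simp [mul_right_comm]
    | succ m hm ih =>
      intro hmL
      have ih := ih (by omega)
      have hsub : Finset.Icc 1 m ⊆ Finset.Icc 1 L := Finset.Icc_subset_Icc_right (by omega)
      have hmem : m + 1 ∈ Finset.Icc 1 L := by simp; omega
      have hS : 0 ≤ ∑ k ∈ Finset.Icc 1 m, Ω k := Finset.sum_nonneg fun i hi => hΩ i (hsub hi)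
      have hP : 0 < ∑ k ∈ Finset.Icc 1 m, lam k :=
        Finset.sum_pos (fun i hi => hlam i (hsub hi)) ⟨1, by simp; omega⟩
      have hP1 : ∑ k ∈ Finset.Icc 1 m, lam k ≤ 1 := by
        rw [← hlam_sum]
        exact Finset.sum_le_sum_of_subset_of_nonneg hsub fun i hi _ => (hlam i hi).le
      have hI : Finset.Ico 1 (m + 1) = Finset.Icc 1 m := by ext; simp
      have hg := hg_pos _ hmem
      have hO := hΩ _ hmem
      have hl := hlam _ hmem
      have hgm := hg_mono m (m + 1) hm (by omega) hmL
      simp only [Finset.sum_Icc_succ_top (show 1 ≤ m + 1 by omega), hI]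
      generalize ∑ k ∈ Finset.Icc 1 m, Ω k = S at *
      generalize ∑ k ∈ Finset.Icc 1 m, lam k = P at *
      have h1 := aux_mono (x := ρ * g (m + 1) * S) (y := ρ * g m * S) hP hP1 (by positivity)
        (by gcongr)
      have h2 := aux_two (a := ρ * g (m + 1) * S) (b := ρ * Ω (m + 1) * g (m + 1)) hP hl
        (by positivity) (by positivity)
      have e1 : 1 + ρ * Ω (m + 1) * g (m + 1) / (1 + ρ * g (m + 1) * S) =
          (1 + ρ * g (m + 1) * (S + Ω (m + 1))) / (1 + ρ * g (m + 1) * S) := by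
        field_simp
        ring
      have e2 : ρ * g (m + 1) * S + ρ * Ω (m + 1) * g (m + 1) =
          ρ * g (m + 1) * (S + Ω (m + 1)) := by ring
      rw [e1, Real.log_div (by positivity) (by positivity)]
      rw [e2] at h2
      linarith
  have h := key L hL le_rfl
  rw [hlam_sum] at h
  simp only [div_one, one_mul, sub_self] at h
  simp only [Real.logb, ← mul_div_assoc, ← Finset.sum_div]
  have h2 : 0 < Real.log 2 := Real.log_pos (by norm_num)
  exact div_le_div_of_nonneg_right (by linarith) h2.le
end

section
/- Let L ≥ 1, ρ > 0, and g₁ ≥ g₂ ≥ … ≥ g_L > 0. Then the MIMO-OMA sum channel capacity does not exceed the MIMO-NOMA sum channel capacity: sup over all (Ω, λ) with Ω_l ≥ 0, ∑_l Ω_l = 1, λ_l > 0, ∑_l λ_l = 1 of ∑_{l=1}^L λ_l·log₂(1 + ρΩ_l g_l/λ_l) is less than or equal to sup over all Ω with Ω_l ≥ 0, ∑_l Ω_l = 1 of ∑_{l=1}^L log₂(1 + ρΩ_l g_l / (1 + ρ g_l ∑_{k<l} Ω_k)). -/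
open Finset

/-- The MIMO-OMA sum channel capacity (supremum of the OMA sum rate over power splits and
degrees-of-freedom splits) does not exceed the MIMO-NOMA sum channel capacity (supremum of
the NOMA sum rate over power splits). -/
theorem oma_capacity_le_noma_capacity (L : ℕ) (hL : 1 ≤ L) (ρ : ℝ) (hρ : 0 < ρ) (g : ℕ → ℝ)
    (hg_pos : ∀ i ∈ Finset.Icc 1 L, 0 < g i)
    (hg_mono : ∀ i j, 1 ≤ i → i ≤ j → j ≤ L → g j ≤ g i) :
    sSup {S : ℝ | ∃ Ω lam : ℕ → ℝ,
        (∀ i ∈ Finset.Icc 1 L, 0 ≤ Ω i) ∧ (∑ l ∈ Finset.Icc 1 L, Ω l = 1) ∧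
        (∀ i ∈ Finset.Icc 1 L, 0 < lam i) ∧ (∑ l ∈ Finset.Icc 1 L, lam l = 1) ∧
        S = ∑ l ∈ Finset.Icc 1 L, lam l * Real.logb 2 (1 + ρ * Ω l * g l / lam l)} ≤
    sSup {S : ℝ | ∃ Ω : ℕ → ℝ,
        (∀ i ∈ Finset.Icc 1 L, 0 ≤ Ω i) ∧ (∑ l ∈ Finset.Icc 1 L, Ω l = 1) ∧
        S = ∑ l ∈ Finset.Icc 1 L,
              Real.logb 2 (1 + ρ * Ω l * g l / (1 + ρ * g l * ∑ k ∈ Finset.Ico 1 l, Ω k))} := by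
  have h1L : 1 ∈ Finset.Icc 1 L := Finset.mem_Icc.mpr ⟨le_refl 1, hL⟩
  have hg1 : 0 < g 1 := hg_pos 1 h1L
  have hB : 0 ≤ Real.logb 2 (1 + ρ * g 1) := by
    apply Real.logb_nonneg (by norm_num)
    have := mul_pos hρ hg1
    linarith
  -- NOMA capacity is at least the rate of the best user
  have hlow : Real.logb 2 (1 + ρ * g 1) ≤ sSup {S : ℝ | ∃ Ω : ℕ → ℝ,
        (∀ i ∈ Finset.Icc 1 L, 0 ≤ Ω i) ∧ (∑ l ∈ Finset.Icc 1 L, Ω l = 1) ∧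
        S = ∑ l ∈ Finset.Icc 1 L,
              Real.logb 2 (1 + ρ * Ω l * g l / (1 + ρ * g l * ∑ k ∈ Finset.Ico 1 l, Ω k))} := by
    apply le_csSup
    · refine ⟨∑ l ∈ Finset.Icc 1 L, Real.logb 2 (1 + ρ * g l), ?_⟩
      rintro S ⟨Ω, hΩ, hsum, rfl⟩
      apply Finset.sum_le_sum
      intro l hl
      have hgl := hg_pos l hl
      have hΩl := hΩ l hl
      have hΩ1 : Ω l ≤ 1 := hsum ▸ Finset.single_le_sum hΩ hl
      have hI : 0 ≤ ∑ k ∈ Finset.Ico 1 l, Ω k := by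
        apply Finset.sum_nonneg
        intro k hk
        apply hΩ
        simp only [Finset.mem_Ico, Finset.mem_Icc] at *
        omega
      have hD : 1 ≤ 1 + ρ * g l * ∑ k ∈ Finset.Ico 1 l, Ω k := by
        have : 0 ≤ ρ * g l * ∑ k ∈ Finset.Ico 1 l, Ω k := by positivity
        linarith
      have hN : 0 ≤ ρ * Ω l * g l := by positivity
      have h2 : ρ * Ω l * g l / (1 + ρ * g l * ∑ k ∈ Finset.Ico 1 l, Ω k) ≤ ρ * Ω l * g l :=
        div_le_self hN hD
      have h3 : ρ * Ω l * g l ≤ ρ * g l := by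
        have := mul_pos hρ hgl
        nlinarith
      apply Real.logb_le_logb_of_le (by norm_num)
      · positivity
      · linarith
    · refine ⟨fun i => if i = 1 then 1 else 0, ?_, ?_, ?_⟩
      · intro i _
        dsimp only
        split_ifs <;> norm_num
      · rw [Finset.sum_ite_eq' (Finset.Icc 1 L) 1 (fun _ => (1 : ℝ)), if_pos h1L]
      · rw [Finset.sum_eq_single_of_mem 1 h1L]
        · simp
        · intro b _ hb
          simp [hb]
  apply Real.sSup_le _ (hB.trans hlow)
  rintro S ⟨Ω, lam, hΩ, hsum, hlam, hlsum, rfl⟩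
  refine le_trans ?_ hlow
  have hpos : ∀ l ∈ Finset.Icc 1 L, 0 < 1 + ρ * Ω l * g l / lam l := by
    intro l hl
    have := hΩ l hl
    have := hg_pos l hl
    have := hlam l hl
    positivity
  have hJ := strictConcaveOn_log_Ioi.concaveOn.le_map_sum (t := Finset.Icc 1 L) (w := lam)
    (p := fun l => 1 + ρ * Ω l * g l / lam l) (fun i hi => (hlam i hi).le) hlsum hpos
  simp only [smul_eq_mul] at hJ
  have hE : ∑ l ∈ Finset.Icc 1 L, lam l * (1 + ρ * Ω l * g l / lam l)
      = 1 + ∑ l ∈ Finset.Icc 1 L, ρ * Ω l * g l := by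
    rw [← hlsum, ← Finset.sum_add_distrib, hlsum]
    apply Finset.sum_congr rfl
    intro l hl
    have := (hlam l hl).ne'
    field_simp
  have hnn : 0 ≤ ∑ l ∈ Finset.Icc 1 L, ρ * Ω l * g l := by
    apply Finset.sum_nonneg
    intro l hl
    have := hΩ l hl
    have := hg_pos l hl
    positivity
  have hle : ∑ l ∈ Finset.Icc 1 L, ρ * Ω l * g l ≤ ρ * g 1 := by
    calc ∑ l ∈ Finset.Icc 1 L, ρ * Ω l * g l ≤ ∑ l ∈ Finset.Icc 1 L, Ω l * (ρ * g 1) := by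
          apply Finset.sum_le_sum
          intro l hl
          have h4 := hΩ l hl
          have hm := Finset.mem_Icc.mp hl
          have h5 := hg_mono 1 l le_rfl hm.1 hm.2
          have h6 := mul_le_mul_of_nonneg_left h5 (mul_nonneg hρ.le h4)
          linarith
      _ = ρ * g 1 := by rw [← Finset.sum_mul, hsum, one_mul]
  have hlog : Real.log (1 + ∑ l ∈ Finset.Icc 1 L, ρ * Ω l * g l) ≤ Real.log (1 + ρ * g 1) :=
    Real.log_le_log (by linarith) (by linarith)
  rw [hE] at hJ
  have h2 : 0 < Real.log 2 := Real.log_pos (by norm_num)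
  simp only [Real.logb, ← mul_div_assoc]
  rw [← Finset.sum_div]
  exact div_le_div_of_nonneg_right (hJ.trans hlog) h2.le
end

section
/- Let (X, μ) be a probability space, L ≥ 1, ρ > 0, let G₁,…,G_L : X → ℝ be measurable functions with G₁(ω) ≥ G₂(ω) ≥ … ≥ G_L(ω) > 0 for μ-almost every ω, and let Ω₁,…,Ω_L ≥ 0 and λ₁,…,λ_L > 0 with ∑_l λ_l = 1 be fixed. Define S^NOMA(ω) = ∑_{l=1}^L log₂(1 + ρΩ_l G_l(ω)/(1 + ρ G_l(ω) ∑_{k<l} Ω_k)) and S^OMA(ω) = ∑_{l=1}^L λ_l log₂(1 + ρΩ_l G_l(ω)/λ_l). If S^NOMA and S^OMA are integrable, then ∫ S^NOMA dμ ≥ ∫ S^OMA dμ; that is, the ergodic sum rate of MIMO-NOMA is at least that of MIMO-OMA for the same power split, regardless of the channel distribution. -/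
open Finset MeasureTheory

lemma log_concave_aux {a b u v : ℝ} (ha : 0 ≤ a) (hb : 0 ≤ b) (hab : a + b = 1)
    (hu : 0 < u) (hv : 0 < v) :
    a * Real.log u + b * Real.log v ≤ Real.log (a * u + b * v) := by
  have h := strictConcaveOn_log_Ioi.concaveOn.2 (Set.mem_Ioi.2 hu) (Set.mem_Ioi.2 hv) ha hb hab
  simpa using h

lemma log_merge {a b x y : ℝ} (ha : 0 < a) (hb : 0 < b) (hx : 0 ≤ x) (hy : 0 ≤ y) :
    a * Real.log (1 + x / a) + b * Real.log (1 + y / b) ≤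
      (a + b) * Real.log (1 + (x + y) / (a + b)) := by
  have hs : 0 < a + b := by positivity
  have h := log_concave_aux (a := a / (a + b)) (b := b / (a + b)) (u := 1 + x / a)
    (v := 1 + y / b) (by positivity) (by positivity) (by field_simp) (by positivity)
    (by positivity)
  have e : a / (a + b) * (1 + x / a) + b / (a + b) * (1 + y / b) = 1 + (x + y) / (a + b) := by
    field_simp
    ring
  rw [e] at h
  have h2 := mul_le_mul_of_nonneg_left h hs.le
  refine le_trans (le_of_eq ?_) h2
  field_simp

lemma log_gap_mono {c x y : ℝ} (hc : 0 < c) (hc1 : c ≤ 1) (hy : 0 ≤ y) (hyx : y ≤ x) :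
    Real.log (1 + y) - c * Real.log (1 + y / c) ≤
      Real.log (1 + x) - c * Real.log (1 + x / c) := by
  have hx : 0 ≤ x := hy.trans hyx
  have h := log_concave_aux (a := c) (b := 1 - c) (u := (1 + x / c) / (1 + y / c)) (v := 1)
    hc.le (by linarith) (by ring) (by positivity) one_pos
  rw [Real.log_div (by positivity) (by positivity), Real.log_one] at h
  have h2 : Real.log (c * ((1 + x / c) / (1 + y / c)) + (1 - c) * 1) ≤
      Real.log ((1 + x) / (1 + y)) := by
    have e : c * ((1 + x / c) / (1 + y / c)) + (1 - c) * 1 = 1 + c * (x - y) / (c + y) := by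
      field_simp
      ring
    have e2 : (1 + x) / (1 + y) = 1 + (x - y) / (1 + y) := by
      field_simp
      ring
    have hd : 0 ≤ x - y := by linarith
    rw [e, e2]
    apply Real.log_le_log (by positivity)
    gcongr 1 + ?_
    rw [div_le_div_iff₀ (by positivity) (by positivity)]
    nlinarith [mul_nonneg hd (mul_nonneg hy (sub_nonneg.2 hc1))]
  rw [Real.log_div (by positivity) (by positivity)] at h2
  linarith

lemma noma_aux (L : ℕ) (g Ω lam : ℕ → ℝ)
    (hmono : ∀ i j, 1 ≤ i → i ≤ j → j ≤ L → g j ≤ g i)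
    (hg : ∀ i ∈ Finset.Icc 1 L, 0 < g i)
    (hΩ : ∀ i ∈ Finset.Icc 1 L, 0 ≤ Ω i)
    (hlam : ∀ i ∈ Finset.Icc 1 L, 0 < lam i)
    (hlam_sum : ∑ l ∈ Finset.Icc 1 L, lam l = 1) (n : ℕ) (hn : 1 ≤ n) : n ≤ L →
    (∑ l ∈ Finset.Icc 1 n, lam l * Real.log (1 + Ω l * g l / lam l)) +
      (Real.log (1 + g n * ∑ k ∈ Finset.Icc 1 n, Ω k) - (∑ k ∈ Finset.Icc 1 n, lam k) *
        Real.log (1 + (g n * ∑ k ∈ Finset.Icc 1 n, Ω k) / ∑ k ∈ Finset.Icc 1 n, lam k)) ≤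
    ∑ l ∈ Finset.Icc 1 n, Real.log (1 + Ω l * g l / (1 + g l * ∑ k ∈ Finset.Ico 1 l, Ω k)) := by
  induction n, hn using Nat.le_induction with
  | base =>
    intro _
    simp [mul_comm]
  | succ n hn ih =>
    intro hL
    have ih := ih (by omega)
    have hsub : Finset.Icc 1 n ⊆ Finset.Icc 1 L := Finset.Icc_subset_Icc_right (by omega)
    have hmem : n + 1 ∈ Finset.Icc 1 L := Finset.mem_Icc.2 ⟨by omega, hL⟩
    have hc : 0 < ∑ k ∈ Finset.Icc 1 n, lam k :=
      Finset.sum_pos (fun i hi => hlam i (hsub hi)) ⟨1, Finset.mem_Icc.2 ⟨le_rfl, hn⟩⟩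
    have hc1 : ∑ k ∈ Finset.Icc 1 n, lam k ≤ 1 := by
      rw [← hlam_sum]
      exact Finset.sum_le_sum_of_subset_of_nonneg hsub (fun i hi _ => (hlam i hi).le)
    have hP : 0 ≤ ∑ k ∈ Finset.Icc 1 n, Ω k := Finset.sum_nonneg (fun i hi => hΩ i (hsub hi))
    have hI : Finset.Ico 1 (n + 1) = Finset.Icc 1 n := by
      ext i
      simp only [Finset.mem_Ico, Finset.mem_Icc]
      omega
    simp only [Finset.sum_Icc_succ_top (show 1 ≤ n + 1 by omega), hI]
    have hgn := hg _ hmem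
    have hgm := hmono n (n + 1) hn (by omega) hL
    have hl := hlam _ hmem
    have hO := hΩ _ hmem
    generalize (∑ k ∈ Finset.Icc 1 n, lam k) = c at *
    generalize (∑ k ∈ Finset.Icc 1 n, Ω k) = P at *
    have h1 := log_gap_mono hc hc1 (mul_nonneg hgn.le hP) (mul_le_mul_of_nonneg_right hgm hP)
    have h2 := log_merge hc hl (mul_nonneg hgn.le hP) (mul_nonneg hO hgn.le)
    have e : 1 + Ω (n + 1) * g (n + 1) / (1 + g (n + 1) * P) =
        (1 + g (n + 1) * (P + Ω (n + 1))) / (1 + g (n + 1) * P) := by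
      field_simp
      ring
    have e2 : g (n + 1) * P + Ω (n + 1) * g (n + 1) = g (n + 1) * (P + Ω (n + 1)) := by ring
    rw [e2] at h2
    rw [e, Real.log_div (by positivity) (by positivity)]
    linarith

/-- Ergodic sum-rate comparison: for almost-surely ordered positive random channel gains and
a fixed power split, the ergodic sum rate of MIMO-NOMA is at least that of MIMO-OMA,
regardless of the channel distribution. -/
theorem noma_ergodic_ge_oma_ergodic
    {X : Type*} [MeasurableSpace X] (μ : Measure X) [IsProbabilityMeasure μ]
    (L : ℕ) (hL : 1 ≤ L) (ρ : ℝ) (hρ : 0 < ρ) (G : ℕ → X → ℝ)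
    (hGmeas : ∀ i ∈ Finset.Icc 1 L, Measurable (G i))
    (hord : ∀ᵐ ω ∂μ, (∀ i j, 1 ≤ i → i ≤ j → j ≤ L → G j ω ≤ G i ω) ∧
      (∀ i ∈ Finset.Icc 1 L, 0 < G i ω))
    (Ω lam : ℕ → ℝ)
    (hΩ : ∀ i ∈ Finset.Icc 1 L, 0 ≤ Ω i)
    (hlam : ∀ i ∈ Finset.Icc 1 L, 0 < lam i)
    (hlam_sum : ∑ l ∈ Finset.Icc 1 L, lam l = 1)
    (hint_noma : Integrable (fun ω => ∑ l ∈ Finset.Icc 1 L,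
        Real.logb 2 (1 + ρ * Ω l * G l ω / (1 + ρ * G l ω * ∑ k ∈ Finset.Ico 1 l, Ω k))) μ)
    (hint_oma : Integrable (fun ω => ∑ l ∈ Finset.Icc 1 L,
        lam l * Real.logb 2 (1 + ρ * Ω l * G l ω / lam l)) μ) :
    ∫ ω, (∑ l ∈ Finset.Icc 1 L, lam l * Real.logb 2 (1 + ρ * Ω l * G l ω / lam l)) ∂μ ≤
      ∫ ω, (∑ l ∈ Finset.Icc 1 L,
        Real.logb 2 (1 + ρ * Ω l * G l ω / (1 + ρ * G l ω * ∑ k ∈ Finset.Ico 1 l, Ω k))) ∂μ := by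
  refine integral_mono_ae hint_oma hint_noma ?_
  filter_upwards [hord] with ω hω
  obtain ⟨hm, hp⟩ := hω
  have h := noma_aux L (fun i => ρ * G i ω) Ω lam
    (fun i j h1 h2 h3 => mul_le_mul_of_nonneg_left (hm i j h1 h2 h3) hρ.le)
    (fun i hi => mul_pos hρ (hp i hi)) hΩ hlam hlam_sum L hL le_rfl
  rw [hlam_sum] at h
  simp only [div_one, one_mul, sub_self, add_zero] at h
  have h2 : 0 < Real.log 2 := Real.log_pos (by norm_num)
  have h3 := div_le_div_of_nonneg_right h h2.le
  rw [Finset.sum_div, Finset.sum_div] at h3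
  have ec : ∀ l, Ω l * (ρ * G l ω) = ρ * Ω l * G l ω := fun l => by ring
  simpa only [Real.logb, mul_div_assoc', ec] using h3
end

section
/- Let x ≥ y > 0 be real numbers. For Ω ∈ [0,1], define the sum-rate gap ΔS(Ω) = log₂(1 + Ωx) + log₂(1 + (1−Ω)y/(1 + Ωy)) − log₂(1 + Ωx + (1−Ω)y). Then ΔS is maximized on [0,1] at Ω* = (√(x+1) − 1)/x; that is, 0 < Ω* < 1 and ΔS(Ω*) ≥ ΔS(Ω) for all Ω ∈ [0,1]. Moreover, ΔS is increasing on [0, Ω*] and decreasing on [Ω*, 1]. -/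
lemma gap_form (x y t : ℝ) (hy : 0 < y) (hxy : y ≤ x) (h0 : 0 ≤ t) (h1 : t ≤ 1) :
    Real.logb 2 (1 + t * x) + Real.logb 2 (1 + (1 - t) * y / (1 + t * y)) -
        Real.logb 2 (1 + t * x + (1 - t) * y) =
      Real.logb 2 ((1 + t * x) * (1 + y) / ((1 + t * y) * (1 + t * x + (1 - t) * y))) := by
  have hx : 0 < x := lt_of_lt_of_le hy hxy
  have h2 : 0 ≤ 1 - t := by linarith
  have p1 : 0 < 1 + t * x := by positivity
  have p2 : 0 < 1 + t * y := by positivity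
  have p3 : 0 < 1 + t * x + (1 - t) * y := by positivity
  have p4 : 0 < 1 + (1 - t) * y / (1 + t * y) := by positivity
  rw [← Real.logb_mul p1.ne' p4.ne', ← Real.logb_div (by positivity) p3.ne']
  congr 1
  field_simp
  ring

lemma gap_le (x y a b : ℝ) (hy : 0 < y) (hxy : y ≤ x) (ha0 : 0 ≤ a) (ha1 : a ≤ 1)
    (hb0 : 0 ≤ b) (hb1 : b ≤ 1) (h : 0 ≤ (b - a) * (1 - (a + b) - x * a * b)) :
    Real.logb 2 (1 + a * x) + Real.logb 2 (1 + (1 - a) * y / (1 + a * y)) -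
        Real.logb 2 (1 + a * x + (1 - a) * y) ≤
    Real.logb 2 (1 + b * x) + Real.logb 2 (1 + (1 - b) * y / (1 + b * y)) -
        Real.logb 2 (1 + b * x + (1 - b) * y) := by
  rw [gap_form x y a hy hxy ha0 ha1, gap_form x y b hy hxy hb0 hb1]
  have hx : 0 < x := lt_of_lt_of_le hy hxy
  have ha2 : 0 ≤ 1 - a := by linarith
  have hb2 : 0 ≤ 1 - b := by linarith
  apply Real.logb_le_logb_of_le (by norm_num) (by positivity)
  rw [div_le_div_iff₀ (by positivity) (by positivity)]
  have hd : 0 ≤ x - y := by linarith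
  have := mul_nonneg (mul_nonneg (mul_nonneg (by linarith : 0 ≤ 1 + y) hy.le) hd) h
  nlinarith [this]

/-- The two-user sum-rate gap ΔS(Ω) between MIMO-NOMA and MIMO-OMA is maximized on [0,1]
at Ω* = (√(x+1) − 1)/x, with 0 < Ω* < 1; moreover ΔS is increasing on [0, Ω*] and
decreasing on [Ω*, 1]. -/
theorem sum_rate_gap_maximizer (x y : ℝ) (hy : 0 < y) (hxy : y ≤ x) :
    let ΔS : ℝ → ℝ := fun Ω =>
      Real.logb 2 (1 + Ω * x) + Real.logb 2 (1 + (1 - Ω) * y / (1 + Ω * y)) -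
        Real.logb 2 (1 + Ω * x + (1 - Ω) * y)
    let Ωstar : ℝ := (Real.sqrt (x + 1) - 1) / x
    0 < Ωstar ∧ Ωstar < 1 ∧ (∀ Ω ∈ Set.Icc (0 : ℝ) 1, ΔS Ω ≤ ΔS Ωstar) ∧
      MonotoneOn ΔS (Set.Icc 0 Ωstar) ∧ AntitoneOn ΔS (Set.Icc Ωstar 1) := by
  intro ΔS s
  have hx : 0 < x := lt_of_lt_of_le hy hxy
  have hr : Real.sqrt (x + 1) ^ 2 = x + 1 := Real.sq_sqrt (by linarith)
  have hr1 : 1 < Real.sqrt (x + 1) := by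
    rw [Real.lt_sqrt (by norm_num)]; linarith
  have hs0 : 0 < s := div_pos (by linarith) hx
  have hsx : s * x = Real.sqrt (x + 1) - 1 := div_mul_cancel₀ _ hx.ne'
  have hq : x * s * s + 2 * s = 1 := by
    have : x * (x * s * s + 2 * s) = x * 1 := by
      have h2 : Real.sqrt (x + 1) = s * x + 1 := by linarith
      rw [h2] at hr
      linarith
    exact mul_left_cancel₀ hx.ne' this
  have hs1 : s < 1 := by
    have : 0 ≤ x * s * s := by positivity
    linarith
  have hm : MonotoneOn ΔS (Set.Icc 0 s) := by
    rintro a ⟨ha0, ha1⟩ b ⟨hb0, hb1⟩ hab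
    apply gap_le x y a b hy hxy ha0 (by linarith) hb0 (by linarith)
    apply mul_nonneg (by linarith)
    have : x * a * b ≤ x * s * s := by gcongr
    linarith
  have ha : AntitoneOn ΔS (Set.Icc s 1) := by
    rintro a ⟨ha0, ha1⟩ b ⟨hb0, hb1⟩ hab
    apply gap_le x y b a hy hxy (by linarith) hb1 (by linarith) ha1
    apply mul_nonneg_of_nonpos_of_nonpos (by linarith)
    have : x * s * s ≤ x * b * a := by
      have hb : 0 ≤ b := by linarith
      gcongr
    linarith
  refine ⟨hs0, hs1, ?_, hm, ha⟩
  rintro t ⟨h0, h1⟩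
  rcases le_total t s with h | h
  · exact hm ⟨h0, h⟩ ⟨hs0.le, le_rfl⟩ h
  · exact ha ⟨le_rfl, hs1.le⟩ ⟨h, h1⟩ h
end

section
/- Let l ≥ 1 and let Ξ₁ ≥ Ξ₂ ≥ … ≥ Ξ_{l+1} > 0 be real numbers. Let Ω₁,…,Ω_l ≥ 0 with ∑_{k=1}^l Ω_k = 1, and let Θ₁,…,Θ_{l+1} ≥ 0 with ∑_{k=1}^{l+1} Θ_k = 1 and Θ_k ≤ Ω_k for every k ∈ {1,…,l}. Then ∑_{k=1}^{l+1} log₂(1 + Θ_k Ξ_k/(1 + Ξ_k ∑_{i=1}^{k−1} Θ_i)) ≤ ∑_{k=1}^{l} log₂(1 + Ω_k Ξ_k/(1 + Ξ_k ∑_{i=1}^{k−1} Ω_i)). That is, admitting an additional user to a MIMO-NOMA cluster (while not increasing any existing user's power coefficient) never increases the sum rate. -/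
open Finset

lemma term_split (c x S : ℝ) (hc : 0 ≤ c) (hx : 0 < x) (hS : 0 ≤ S) :
    Real.logb 2 (1 + c * x / (1 + x * S)) =
      Real.logb 2 (1 + x * (S + c)) - Real.logb 2 (1 + x * S) := by
  have h1 : 0 < 1 + x * S := by positivity
  have h2 : 0 < 1 + x * (S + c) := by positivity
  rw [← Real.logb_div h2.ne' h1.ne']
  congr 1
  field_simp
  ring

lemma gap_mono (x y A T : ℝ) (hy : 0 < y) (hyx : y ≤ x) (hT : 0 ≤ T) (hTA : T ≤ A) :
    Real.logb 2 (1 + y * A) - Real.logb 2 (1 + y * T) ≤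
      Real.logb 2 (1 + x * A) - Real.logb 2 (1 + x * T) := by
  have hx : 0 < x := hy.trans_le hyx
  have hA : 0 ≤ A := hT.trans hTA
  have h1 : 0 < 1 + y * A := by positivity
  have h2 : 0 < 1 + y * T := by positivity
  have h3 : 0 < 1 + x * A := by positivity
  have h4 : 0 < 1 + x * T := by positivity
  rw [← Real.logb_div h1.ne' h2.ne', ← Real.logb_div h3.ne' h4.ne']
  apply Real.logb_le_logb_of_le (by norm_num) (by positivity)
  rw [div_le_div_iff₀ h2 h4]
  nlinarith [mul_nonneg (sub_nonneg.2 hyx) (sub_nonneg.2 hTA)]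

/-- Admitting an additional user to a MIMO-NOMA cluster (while not increasing any existing
user's power coefficient) never increases the sum rate. -/
theorem sum_rate_decreases_with_extra_user (l : ℕ) (hl : 1 ≤ l) (Ξ Ω Θ : ℕ → ℝ)
    (hΞ_pos : ∀ k ∈ Finset.Icc 1 (l + 1), 0 < Ξ k)
    (hΞ_mono : ∀ i j, 1 ≤ i → i ≤ j → j ≤ l + 1 → Ξ j ≤ Ξ i)
    (hΩ : ∀ k ∈ Finset.Icc 1 l, 0 ≤ Ω k)
    (hΩ_sum : ∑ k ∈ Finset.Icc 1 l, Ω k = 1)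
    (hΘ : ∀ k ∈ Finset.Icc 1 (l + 1), 0 ≤ Θ k)
    (hΘ_sum : ∑ k ∈ Finset.Icc 1 (l + 1), Θ k = 1)
    (hΘΩ : ∀ k ∈ Finset.Icc 1 l, Θ k ≤ Ω k) :
    ∑ k ∈ Finset.Icc 1 (l + 1),
        Real.logb 2 (1 + Θ k * Ξ k / (1 + Ξ k * ∑ i ∈ Finset.Ico 1 k, Θ i)) ≤
      ∑ k ∈ Finset.Icc 1 l,
        Real.logb 2 (1 + Ω k * Ξ k / (1 + Ξ k * ∑ i ∈ Finset.Ico 1 k, Ω i)) := by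
  have ico : ∀ m, Finset.Ico 1 (m + 1) = Finset.Icc 1 m := by
    intro m; ext i; simp only [Finset.mem_Ico, Finset.mem_Icc]; omega
  have Tnn : ∀ m, m ≤ l + 1 → 0 ≤ ∑ i ∈ Finset.Icc 1 m, Θ i := fun m hm =>
    Finset.sum_nonneg fun i hi => hΘ i (by simp only [Finset.mem_Icc] at *; omega)
  have Ann : ∀ m, m ≤ l → 0 ≤ ∑ i ∈ Finset.Icc 1 m, Ω i := fun m hm =>
    Finset.sum_nonneg fun i hi => hΩ i (by simp only [Finset.mem_Icc] at *; omega)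
  have TA : ∀ m, m ≤ l → ∑ i ∈ Finset.Icc 1 m, Θ i ≤ ∑ i ∈ Finset.Icc 1 m, Ω i := fun m hm =>
    Finset.sum_le_sum fun i hi => hΘΩ i (by simp only [Finset.mem_Icc] at *; omega)
  have key : ∀ m, m ≤ l →
      ∑ k ∈ Finset.Icc 1 m,
        Real.logb 2 (1 + Θ k * Ξ k / (1 + Ξ k * ∑ i ∈ Finset.Ico 1 k, Θ i)) +
      (Real.logb 2 (1 + Ξ (m + 1) * ∑ i ∈ Finset.Icc 1 m, Ω i) -
        Real.logb 2 (1 + Ξ (m + 1) * ∑ i ∈ Finset.Icc 1 m, Θ i)) ≤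
      ∑ k ∈ Finset.Icc 1 m,
        Real.logb 2 (1 + Ω k * Ξ k / (1 + Ξ k * ∑ i ∈ Finset.Ico 1 k, Ω i)) := by
    intro m
    induction m with
    | zero => intro _; simp
    | succ m ih =>
      intro hm
      have ih := ih (by omega)
      have hg := gap_mono (Ξ (m + 1)) (Ξ (m + 1 + 1)) _ _
        (hΞ_pos _ (by simp only [Finset.mem_Icc]; omega))
        (hΞ_mono _ _ (by omega) (by omega) (by omega)) (Tnn (m + 1) (by omega)) (TA (m + 1) hm)
      have hx : 0 < Ξ (m + 1) := hΞ_pos _ (by simp only [Finset.mem_Icc]; omega)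
      have e1 := term_split (Θ (m + 1)) (Ξ (m + 1)) _
        (hΘ _ (by simp only [Finset.mem_Icc]; omega)) hx (Tnn m (by omega))
      have e2 := term_split (Ω (m + 1)) (Ξ (m + 1)) _
        (hΩ _ (by simp only [Finset.mem_Icc]; omega)) hx (Ann m (by omega))
      rw [← Finset.sum_Icc_succ_top (by omega)] at e1 e2
      rw [Finset.sum_Icc_succ_top (by omega) (fun k => Real.logb 2 (1 + Θ k * Ξ k / _)),
        Finset.sum_Icc_succ_top (by omega) (fun k => Real.logb 2 (1 + Ω k * Ξ k / _)),
        ico, e1, e2]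
      linarith
  have hk := key l le_rfl
  have e1 := term_split (Θ (l + 1)) (Ξ (l + 1)) _
    (hΘ _ (by simp only [Finset.mem_Icc]; omega))
    (hΞ_pos _ (by simp only [Finset.mem_Icc]; omega)) (Tnn l (by omega))
  rw [← Finset.sum_Icc_succ_top (by omega), hΘ_sum] at e1
  rw [hΩ_sum] at hk
  rw [Finset.sum_Icc_succ_top (by omega), ico, e1]
  linarith
end

section
/- Let 2 ≤ l, let Ξ₂ ≥ Ξ₃ ≥ … ≥ Ξ_l > 0, and let Θ₁,…, and Ω₁,… be nonnegative real numbers such that ∑_{i=1}^{k} Θ_i ≤ ∑_{i=1}^{k} Ω_i for every k ∈ {2,…,l−1}. Then ∏_{k=2}^{l−1} [(1 + (∑_{i=1}^{k} Θ_i)·Ξ_k)·(1 + (∑_{i=1}^{k} Ω_i)·Ξ_{k+1})] / [(1 + (∑_{i=1}^{k} Ω_i)·Ξ_k)·(1 + (∑_{i=1}^{k} Θ_i)·Ξ_{k+1})] ≤ 1. -/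
open Finset

/-- The factor Λ₂ in the sum-rate difference decomposition is at most 1. -/
theorem lambda2_le_one (l : ℕ) (hl : 2 ≤ l) (Ξ Θ Ω : ℕ → ℝ)
    (hΞ_pos : ∀ k ∈ Finset.Icc 2 l, 0 < Ξ k)
    (hΞ_mono : ∀ i j, 2 ≤ i → i ≤ j → j ≤ l → Ξ j ≤ Ξ i)
    (hΘ : ∀ i ∈ Finset.Icc 1 (l - 1), 0 ≤ Θ i)
    (hΩ : ∀ i ∈ Finset.Icc 1 (l - 1), 0 ≤ Ω i)
    (hΘΩ : ∀ k, 2 ≤ k → k ≤ l - 1 →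
      ∑ i ∈ Finset.Icc 1 k, Θ i ≤ ∑ i ∈ Finset.Icc 1 k, Ω i) :
    ∏ k ∈ Finset.Icc 2 (l - 1),
        ((1 + (∑ i ∈ Finset.Icc 1 k, Θ i) * Ξ k) *
            (1 + (∑ i ∈ Finset.Icc 1 k, Ω i) * Ξ (k + 1))) /
          ((1 + (∑ i ∈ Finset.Icc 1 k, Ω i) * Ξ k) *
            (1 + (∑ i ∈ Finset.Icc 1 k, Θ i) * Ξ (k + 1))) ≤ 1 := by
  have key : ∀ k ∈ Finset.Icc 2 (l - 1),
      0 ≤ ∑ i ∈ Finset.Icc 1 k, Θ i ∧ 0 ≤ ∑ i ∈ Finset.Icc 1 k, Ω i ∧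
      ∑ i ∈ Finset.Icc 1 k, Θ i ≤ ∑ i ∈ Finset.Icc 1 k, Ω i ∧
      0 < Ξ k ∧ 0 < Ξ (k + 1) ∧ Ξ (k + 1) ≤ Ξ k := by
    intro k hk
    rw [Finset.mem_Icc] at hk
    refine ⟨Finset.sum_nonneg fun i hi => hΘ i ?_, Finset.sum_nonneg fun i hi => hΩ i ?_,
      hΘΩ k hk.1 hk.2, hΞ_pos k ?_, hΞ_pos (k + 1) ?_,
      hΞ_mono k (k + 1) hk.1 (by omega) (by omega)⟩
    all_goals simp only [Finset.mem_Icc] at *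
    all_goals omega
  apply Finset.prod_le_one
  · intro k hk
    obtain ⟨h1, h2, h3, h4, h5, h6⟩ := key k hk
    positivity
  · intro k hk
    obtain ⟨h1, h2, h3, h4, h5, h6⟩ := key k hk
    apply div_le_one_of_le₀
    · nlinarith [mul_nonneg (sub_nonneg.2 h3) (sub_nonneg.2 h6)]
    · positivity
end

section
/- Let l ≥ 1, ρ > 0, and let Γ₁,…,Γ_l and g₁,…,g_l be positive real numbers. Define Ω₁,…,Ω_l recursively by Ω_k = Γ_k·(∑_{i=1}^{k−1} Ω_i) + Γ_k/(ρ·g_k) for k = 1,…,l (so Ω₁ = Γ₁/(ρg₁)). Then ∑_{k=1}^{l} Ω_k = ∑_{k=1}^{l} (Γ_k/(ρ·g_k))·∏_{i=k+1}^{l} (Γ_i + 1). -/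
open Finset

/-- Closed form for the total power consumed by the greedy user admission scheme: if each
admitted user gets exactly the minimum power meeting its SINR requirement, then
∑_{k=1}^{l} Ω_k = ∑_{k=1}^{l} (Γ_k/(ρ g_k))·∏_{i=k+1}^{l} (Γ_i + 1). -/
theorem greedy_total_power_closed_form (l : ℕ) (hl : 1 ≤ l) (ρ : ℝ) (hρ : 0 < ρ)
    (Γ g Ω : ℕ → ℝ)
    (hΓ : ∀ k ∈ Finset.Icc 1 l, 0 < Γ k)
    (hg : ∀ k ∈ Finset.Icc 1 l, 0 < g k)
    (hrec : ∀ k ∈ Finset.Icc 1 l,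
      Ω k = Γ k * (∑ i ∈ Finset.Ico 1 k, Ω i) + Γ k / (ρ * g k)) :
    ∑ k ∈ Finset.Icc 1 l, Ω k =
      ∑ k ∈ Finset.Icc 1 l, (Γ k / (ρ * g k)) * ∏ i ∈ Finset.Icc (k + 1) l, (Γ i + 1) := by
  clear hΓ hg hl
  induction l with
  | zero => simp
  | succ n ih =>
    have ih' := ih (fun k hk => hrec k (by
      rw [Finset.mem_Icc] at hk ⊢
      omega))
    have h := hrec (n + 1) (by simp)
    have hI : Finset.Ico 1 (n + 1) = Finset.Icc 1 n := by
      ext x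
      simp only [Finset.mem_Ico, Finset.mem_Icc]
      omega
    rw [hI] at h
    rw [Finset.sum_Icc_succ_top (by omega), Finset.sum_Icc_succ_top (by omega), h]
    have h2 : ∑ k ∈ Finset.Icc 1 n,
        (Γ k / (ρ * g k)) * ∏ i ∈ Finset.Icc (k + 1) (n + 1), (Γ i + 1)
        = (∑ k ∈ Finset.Icc 1 n,
          (Γ k / (ρ * g k)) * ∏ i ∈ Finset.Icc (k + 1) n, (Γ i + 1)) * (Γ (n + 1) + 1) := by
      rw [Finset.sum_mul]
      refine Finset.sum_congr rfl (fun k hk => ?_)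
      rw [Finset.mem_Icc] at hk
      rw [Finset.prod_Icc_succ_top (by omega), mul_assoc]
    rw [h2, ← ih', Finset.Icc_eq_empty (by omega : ¬ (n + 1 + 1 ≤ n + 1)), Finset.prod_empty]
    ring
end

section
/- Let l ≥ 1, ρ > 0, and let Γ₁,…,Γ_l and g₁,…,g_l be positive real numbers. If nonnegative real numbers Ω₁,…,Ω_l satisfy Ω_k ≥ Γ_k·(∑_{i=1}^{k−1} Ω_i) + Γ_k/(ρ·g_k) for every k = 1,…,l, then ∑_{k=1}^{l} Ω_k ≥ ∑_{k=1}^{l} (Γ_k/(ρ·g_k))·∏_{i=k+1}^{l} (Γ_i + 1). In other words, any power allocation meeting all l users' SINR constraints uses at least the total power of the allocation that meets each constraint with equality. -/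
open Finset

/-- Any power allocation meeting all l users' SINR constraints uses at least the total power
of the allocation that meets each constraint with equality. -/
theorem feasible_power_ge_greedy (l : ℕ) (hl : 1 ≤ l) (ρ : ℝ) (hρ : 0 < ρ)
    (Γ g Ω : ℕ → ℝ)
    (hΓ : ∀ k ∈ Finset.Icc 1 l, 0 < Γ k)
    (hg : ∀ k ∈ Finset.Icc 1 l, 0 < g k)
    (hΩ : ∀ k ∈ Finset.Icc 1 l, 0 ≤ Ω k)
    (hconstr : ∀ k ∈ Finset.Icc 1 l,
      Ω k ≥ Γ k * (∑ i ∈ Finset.Ico 1 k, Ω i) + Γ k / (ρ * g k)) :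
    ∑ k ∈ Finset.Icc 1 l, Ω k ≥
      ∑ k ∈ Finset.Icc 1 l, (Γ k / (ρ * g k)) * ∏ i ∈ Finset.Icc (k + 1) l, (Γ i + 1) := by
  have key : ∀ m : ℕ, m ≤ l →
      ∑ k ∈ Finset.Icc 1 m, (Γ k / (ρ * g k)) * ∏ i ∈ Finset.Icc (k + 1) m, (Γ i + 1)
        ≤ ∑ k ∈ Finset.Icc 1 m, Ω k := by
    intro m
    induction m with
    | zero => intro _; simp
    | succ n ih =>
      intro hn
      have ih' := ih (by omega)
      have hmem : n + 1 ∈ Finset.Icc 1 l := Finset.mem_Icc.mpr ⟨by omega, hn⟩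
      have hc := hconstr (n + 1) hmem
      have hG := hΓ (n + 1) hmem
      have hI : Finset.Ico 1 (n + 1) = Finset.Icc 1 n := by
        ext x; simp only [Finset.mem_Ico, Finset.mem_Icc]; omega
      rw [hI] at hc
      rw [Finset.sum_Icc_succ_top (by omega), Finset.sum_Icc_succ_top (by omega)]
      have hE : ∑ k ∈ Finset.Icc 1 n,
            (Γ k / (ρ * g k)) * ∏ i ∈ Finset.Icc (k + 1) (n + 1), (Γ i + 1)
          = (∑ k ∈ Finset.Icc 1 n,
            (Γ k / (ρ * g k)) * ∏ i ∈ Finset.Icc (k + 1) n, (Γ i + 1)) * (Γ (n + 1) + 1) := by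
        rw [Finset.sum_mul]
        refine Finset.sum_congr rfl fun k hk => ?_
        have hk' := (Finset.mem_Icc.mp hk).2
        rw [Finset.prod_Icc_succ_top (by omega), mul_assoc]
      have hZ : Finset.Icc (n + 1 + 1) (n + 1) = ∅ := Finset.Icc_eq_empty (by omega)
      rw [hE, hZ, Finset.prod_empty, mul_one]
      have := mul_le_mul_of_nonneg_right ih' (by linarith : (0 : ℝ) ≤ Γ (n + 1) + 1)
      linarith
  exact key l le_rfl
end
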